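/- Concavity of entropy along the heat semigroup (classical case): Let X be a random variable with values in ℝⁿ with probability density, finite second moment and finite differential entropy, and let Z be a standard Gaussian random variable on ℝⁿ independent of X. Then the function t ↦ S(X + √t Z) is concave on [0, ∞). -/

import Mathlib

open MeasureTheory ProbabilityTheory Real Filter

noncomputable section

/-- The standard Gaussian probability measure on `ℝⁿ`. -/
def stdGaussian (n : ℕ) : Measure (EuclideanSpace ℝ (Fin n)) :=
  volume.withDensity fun z => ENNReal.ofReal ((2 * π) ^ (-(n : ℝ) / 2) * Real.exp (-‖z‖ ^ 2 / 2))

/-- The differential entropy `-∫ p ln p` of a measure `μ` with density `p = dμ/dν`. -/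
def diffEntropy {α : Type*} [MeasurableSpace α] (ν μ : Measure α) : ℝ :=
  -∫ x, (μ.rnDeriv ν x).toReal * Real.log ((μ.rnDeriv ν x).toReal) ∂ν

open scoped ENNReal

section General

variable {E : Type*} [NormedAddCommGroup E] [InnerProductSpace ℝ E] [FiniteDimensional ℝ E]
  [MeasurableSpace E] [BorelSpace E]

lemma lintegral_eq_rnDeriv (μ : Measure E) [IsProbabilityMeasure μ] (hμ : μ ≪ volume)
    {f : E → ℝ≥0∞} (hf : Measurable f) :
    ∫⁻ x, f x ∂μ = ∫⁻ x, μ.rnDeriv volume x * f x := by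
  conv_lhs => rw [← Measure.withDensity_rnDeriv_eq μ volume hμ]
  rw [lintegral_withDensity_eq_lintegral_mul _ (Measure.measurable_rnDeriv _ _) hf]
  rfl

lemma conv_eq_withDensity (μ ν : Measure E) [IsProbabilityMeasure μ] [IsProbabilityMeasure ν]
    (hμ : μ ≪ volume) :
    μ.conv ν = volume.withDensity (fun z => ∫⁻ w, μ.rnDeriv volume (z - w) ∂ν) := by
  have hp := Measure.measurable_rnDeriv μ (volume : Measure E)
  refine Measure.ext_of_lintegral _ fun f hf => ?_
  rw [Measure.lintegral_conv hf, lintegral_lintegral_swap (by fun_prop),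
    lintegral_withDensity_eq_lintegral_mul _ (by fun_prop) hf]
  simp only [Pi.mul_apply]
  have e1 : ∀ z, (∫⁻ w, μ.rnDeriv volume (z - w) ∂ν) * f z
      = ∫⁻ w, μ.rnDeriv volume (z - w) * f z ∂ν := fun z =>
    (lintegral_mul_const _ (by fun_prop)).symm
  simp_rw [e1]
  conv_rhs => rw [lintegral_lintegral_swap (by fun_prop)]
  refine lintegral_congr fun y => ?_
  rw [lintegral_eq_rnDeriv μ hμ (by fun_prop),
    ← lintegral_add_right_eq_self (fun z => μ.rnDeriv volume (z - y) * f z) y]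
  simp

lemma rnDeriv_conv_ae (μ ν : Measure E) [IsProbabilityMeasure μ] [IsProbabilityMeasure ν]
    (hμ : μ ≪ volume) :
    (μ.conv ν).rnDeriv volume =ᵐ[volume] (fun z => ∫⁻ w, μ.rnDeriv volume (z - w) ∂ν) := by
  have hp := Measure.measurable_rnDeriv μ (volume : Measure E)
  rw [conv_eq_withDensity μ ν hμ]
  exact Measure.rnDeriv_withDensity _ (by fun_prop)

lemma conv_ac (μ ν : Measure E) [IsProbabilityMeasure μ] [IsProbabilityMeasure ν]
    (hμ : μ ≪ volume) : μ.conv ν ≪ volume := by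
  rw [conv_eq_withDensity μ ν hμ]
  exact withDensity_absolutelyContinuous _ _

lemma diffEntropy_eq (μ : Measure E) [IsProbabilityMeasure μ] (hμ : μ ≪ volume) :
    diffEntropy volume μ = -∫ x, Real.log ((μ.rnDeriv volume x).toReal) ∂μ := by
  rw [diffEntropy, ← integral_rnDeriv_smul hμ]
  rfl

def FinEnt (μ : Measure E) : Prop := Integrable
      (fun x => (μ.rnDeriv volume x).toReal * Real.log ((μ.rnDeriv volume x).toReal)) volume

lemma FinEnt.int {μ : Measure E} [IsProbabilityMeasure μ] (h : FinEnt μ) (hμ : μ ≪ volume) :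
    Integrable (fun x => Real.log ((μ.rnDeriv volume x).toReal)) μ :=
  (integrable_rnDeriv_smul_iff hμ).1 h

lemma gibbs {Ω : Type*} [MeasurableSpace Ω] (P : Measure Ω) [IsProbabilityMeasure P]
    (U : Ω → ℝ≥0∞) (hU : Measurable U) (hpos : ∀ᵐ x ∂P, 0 < (U x).toReal) (hle : ∫⁻ x, U x ∂P ≤ 1)
    (hint : Integrable (fun x => Real.log (U x).toReal) P) :
    ∫ x, Real.log (U x).toReal ∂P ≤ 0 := by
  have hne : ∫⁻ x, U x ∂P ≠ ∞ := ne_top_of_le_ne_top ENNReal.one_ne_top hle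
  have hi : Integrable (fun x => (U x).toReal) P :=
    integrable_toReal_of_lintegral_ne_top hU.aemeasurable hne
  have h1 : ∫ x, (U x).toReal ∂P ≤ 1 := by
    rw [integral_toReal hU.aemeasurable (ae_lt_top hU hne)]
    exact ENNReal.toReal_mono ENNReal.one_ne_top hle
  calc ∫ x, Real.log (U x).toReal ∂P ≤ ∫ x, ((U x).toReal - 1) ∂P := by
        refine integral_mono_ae hint (hi.sub (integrable_const _)) ?_
        filter_upwards [hpos] with x hx
        exact Real.log_le_sub_one_of_pos hx
    _ = ∫ x, (U x).toReal ∂P - 1 := by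
        rw [integral_sub hi (integrable_const _)]; simp
    _ ≤ 0 := by linarith

lemma pull {Ω : Type*} [MeasurableSpace Ω] {P : Measure Ω}
    {μ : Measure E} [IsProbabilityMeasure μ] (hμ : μ ≪ volume) (h : FinEnt μ)
    {T : Ω → E} (hT : MeasurePreserving T P μ) :
    (∀ᵐ z ∂P, 0 < (μ.rnDeriv volume (T z)).toReal) ∧
    Integrable (fun z => Real.log (μ.rnDeriv volume (T z)).toReal) P ∧
    ∫ z, Real.log (μ.rnDeriv volume (T z)).toReal ∂P = - diffEntropy volume μ := by
  have mp : Measurable (μ.rnDeriv volume) := Measure.measurable_rnDeriv _ _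
  have ml : Measurable (fun x => Real.log (μ.rnDeriv volume x).toReal) :=
    Real.measurable_log.comp mp.ennreal_toReal
  refine ⟨?_, hT.integrable_comp_of_integrable (h.int hμ), ?_⟩
  · refine hT.quasiMeasurePreserving.ae (p := fun x => 0 < (μ.rnDeriv volume x).toReal) ?_
    filter_upwards [Measure.rnDeriv_pos hμ, hμ.ae_le (Measure.rnDeriv_lt_top μ volume)]
      with x h1 h2
    exact ENNReal.toReal_pos h1.ne' h2.ne
  · rw [diffEntropy_eq _ hμ, neg_neg]
    have h5 := integral_map (μ := P) hT.measurable.aemeasurable ml.aestronglyMeasurable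
    rw [← h5, hT.map_eq]

lemma entropy_mono (μ ν : Measure E) [IsProbabilityMeasure μ] [IsProbabilityMeasure ν]
    (hμ : μ ≪ volume) (h1 : FinEnt μ) (h2 : FinEnt (μ.conv ν)) :
    diffEntropy volume μ ≤ diffEntropy volume (μ.conv ν) := by
  have hc := conv_ac μ ν hμ
  have P1 : MeasurePreserving (fun z : E × E => z.1) (μ.prod ν) μ := measurePreserving_fst
  have P2 : MeasurePreserving (fun z : E × E => z.1 + z.2) (μ.prod ν) (μ.conv ν) :=
    ⟨by fun_prop, rfl⟩
  obtain ⟨a1, i1, e1⟩ := pull hμ h1 P1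
  obtain ⟨a2, i2, e2⟩ := pull hc h2 P2
  set p := μ.rnDeriv volume with hp
  set q := (μ.conv ν).rnDeriv volume with hq
  have mp : Measurable p := Measure.measurable_rnDeriv _ _
  have mq : Measurable q := Measure.measurable_rnDeriv _ _
  have hcongr : (fun z : E × E => Real.log (q (z.1 + z.2)).toReal - Real.log (p z.1).toReal)
      =ᵐ[μ.prod ν] fun z => Real.log (q (z.1 + z.2) * (p z.1)⁻¹).toReal := by
    filter_upwards [a1, a2] with z hz1 hz2
    simp only [ENNReal.toReal_mul, ENNReal.toReal_inv]
    rw [Real.log_mul hz2.ne' (inv_pos.2 hz1).ne', Real.log_inv, sub_eq_add_neg]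
  have key := gibbs (μ.prod ν) (fun z => q (z.1 + z.2) * (p z.1)⁻¹) (by fun_prop) ?_ ?_
    ((i2.sub i1).congr hcongr)
  rotate_left
  · filter_upwards [a1, a2] with z hz1 hz2
    simp only [ENNReal.toReal_mul, ENNReal.toReal_inv]
    exact mul_pos hz2 (inv_pos.2 hz1)
  · rw [lintegral_prod_symm _ (by fun_prop)]
    calc ∫⁻ y, ∫⁻ x, q (x + y) * (p x)⁻¹ ∂μ ∂ν ≤ ∫⁻ y, 1 ∂ν := by
          refine lintegral_mono fun y => ?_
          rw [lintegral_eq_rnDeriv μ hμ (by fun_prop)]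
          calc ∫⁻ x, p x * (q (x + y) * (p x)⁻¹) ≤ ∫⁻ x, q (x + y) := by
                refine lintegral_mono fun x => ?_
                rw [mul_left_comm]
                exact mul_le_of_le_one_right' (ENNReal.mul_inv_le_one _)
            _ = ∫⁻ x, q x := lintegral_add_right_eq_self _ _
            _ ≤ 1 := by
                simpa using (Measure.lintegral_rnDeriv_le (μ := μ.conv ν) (ν := volume))
      _ = 1 := by simp
  rw [← integral_congr_ae hcongr, integral_sub i2 i1, e1, e2] at key
  linarith

lemma entropy_submod (μ ν κ : Measure E) [IsProbabilityMeasure μ] [IsProbabilityMeasure ν]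
    [IsProbabilityMeasure κ] (hμ : μ ≪ volume) (h1 : FinEnt μ) (h2 : FinEnt (μ.conv ν))
    (h3 : FinEnt (μ.conv κ)) (h4 : FinEnt ((μ.conv ν).conv κ)) :
    diffEntropy volume ((μ.conv ν).conv κ) + diffEntropy volume μ
      ≤ diffEntropy volume (μ.conv ν) + diffEntropy volume (μ.conv κ) := by
  have c2 := conv_ac μ ν hμ
  have c3 := conv_ac μ κ hμ
  have c4 := conv_ac _ κ c2
  have c4' : (μ.conv κ).conv ν = (μ.conv ν).conv κ := by
    rw [Measure.conv_assoc, Measure.conv_comm κ ν, ← Measure.conv_assoc]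
  have d1 := rnDeriv_conv_ae _ κ c2
  have d2 := rnDeriv_conv_ae _ ν c3
  rw [c4'] at d2
  have P1 : MeasurePreserving (fun z : E × E × E => z.1) (μ.prod (ν.prod κ)) μ :=
    measurePreserving_fst
  have hc (a b : Measure E) [IsProbabilityMeasure a] [IsProbabilityMeasure b] :
      MeasurePreserving (fun z : E × E => z.1 + z.2) (a.prod b) (a.conv b) :=
    ⟨by fun_prop, rfl⟩
  have P2 : MeasurePreserving (fun z : E × E × E => z.1 + z.2.1) (μ.prod (ν.prod κ))
      (μ.conv ν) :=
    (hc μ ν).comp ((MeasurePreserving.id μ).prod (measurePreserving_fst (μ := ν) (ν := κ)))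
  have P3 : MeasurePreserving (fun z : E × E × E => z.1 + z.2.2) (μ.prod (ν.prod κ))
      (μ.conv κ) :=
    (hc μ κ).comp ((MeasurePreserving.id μ).prod (measurePreserving_snd (μ := ν) (ν := κ)))
  have P4 : MeasurePreserving (fun z : E × E × E => z.1 + (z.2.1 + z.2.2)) (μ.prod (ν.prod κ))
      ((μ.conv ν).conv κ) := by
    rw [Measure.conv_assoc]
    exact (hc μ (ν.conv κ)).comp ((MeasurePreserving.id μ).prod (hc ν κ))
  obtain ⟨a1, i1, e1⟩ := pull hμ h1 P1
  obtain ⟨a2, i2, e2⟩ := pull c2 h2 P2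
  obtain ⟨a3, i3, e3⟩ := pull c3 h3 P3
  obtain ⟨a4, i4, e4⟩ := pull c4 h4 P4
  have hs1 : ∫⁻ z, ((μ.conv ν).conv κ).rnDeriv volume z ≤ 1 := by
    simpa using (Measure.lintegral_rnDeriv_le (μ := (μ.conv ν).conv κ) (ν := volume))
  set p := μ.rnDeriv volume with hp
  set q := (μ.conv ν).rnDeriv volume with hq
  set r := (μ.conv κ).rnDeriv volume with hr
  set s := ((μ.conv ν).conv κ).rnDeriv volume with hs
  have mp : Measurable p := Measure.measurable_rnDeriv _ _
  have mq : Measurable q := Measure.measurable_rnDeriv _ _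
  have mr : Measurable r := Measure.measurable_rnDeriv _ _
  have ms : Measurable s := Measure.measurable_rnDeriv _ _
  have hcongr : (fun z : E × E × E =>
      Real.log (q (z.1 + z.2.1)).toReal + Real.log (r (z.1 + z.2.2)).toReal
        - (Real.log (p z.1).toReal + Real.log (s (z.1 + (z.2.1 + z.2.2))).toReal))
      =ᵐ[μ.prod (ν.prod κ)] fun z => Real.log ((q (z.1 + z.2.1) * r (z.1 + z.2.2)
        * (s (z.1 + (z.2.1 + z.2.2)))⁻¹) * (p z.1)⁻¹).toReal := by
    filter_upwards [a1, a2, a3, a4] with z hz1 hz2 hz3 hz4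
    simp only [ENNReal.toReal_mul, ENNReal.toReal_inv]
    rw [Real.log_mul (by positivity) (by positivity), Real.log_mul (by positivity) (by positivity),
      Real.log_mul (by positivity) (by positivity), Real.log_inv, Real.log_inv]
    ring
  have key := gibbs (μ.prod (ν.prod κ)) (fun z => (q (z.1 + z.2.1) * r (z.1 + z.2.2)
        * (s (z.1 + (z.2.1 + z.2.2)))⁻¹) * (p z.1)⁻¹) (by fun_prop) ?_ ?_
    (((i2.add i3).sub (i1.add i4)).congr hcongr)
  rotate_left
  · filter_upwards [a1, a2, a3, a4] with z hz1 hz2 hz3 hz4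
    simp only [ENNReal.toReal_mul, ENNReal.toReal_inv]
    positivity
  · rw [lintegral_prod_symm _ (by fun_prop)]
    calc ∫⁻ y : E × E, ∫⁻ x, (q (x + y.1) * r (x + y.2) * (s (x + (y.1 + y.2)))⁻¹) * (p x)⁻¹ ∂μ
            ∂(ν.prod κ)
        ≤ ∫⁻ y : E × E, ∫⁻ z, q (z - y.2) * r (z - y.1) * (s z)⁻¹ ∂volume ∂(ν.prod κ) := by
          refine lintegral_mono fun y => ?_
          rw [lintegral_eq_rnDeriv μ hμ (by fun_prop)]
          calc ∫⁻ x, p x * ((q (x + y.1) * r (x + y.2) * (s (x + (y.1 + y.2)))⁻¹) * (p x)⁻¹)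
              ≤ ∫⁻ x, (q (x + y.1) * r (x + y.2) * (s (x + (y.1 + y.2)))⁻¹) := by
                refine lintegral_mono fun x => ?_
                rw [mul_left_comm]
                exact mul_le_of_le_one_right' (ENNReal.mul_inv_le_one _)
            _ = ∫⁻ z, q (z - y.2) * r (z - y.1) * (s z)⁻¹ := by
                rw [← lintegral_add_right_eq_self
                  (fun z => q (z - y.2) * r (z - y.1) * (s z)⁻¹) (y.1 + y.2)]
                refine lintegral_congr fun x => ?_
                rw [show x + (y.1 + y.2) - y.2 = x + y.1 by abel,
                  show x + (y.1 + y.2) - y.1 = x + y.2 by abel]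
      _ = ∫⁻ z, ∫⁻ y : E × E, r (z - y.1) * q (z - y.2) * (s z)⁻¹ ∂(ν.prod κ) := by
          rw [lintegral_lintegral_swap (by fun_prop)]
          simp_rw [mul_comm (r _) (q _)]
      _ = ∫⁻ z, (∫⁻ y, r (z - y) ∂ν) * (∫⁻ w, q (z - w) ∂κ) * (s z)⁻¹ := by
          refine lintegral_congr fun z => ?_
          rw [lintegral_mul_const _ (by fun_prop),
            lintegral_prod_mul (f := fun y => r (z - y)) (g := fun w => q (z - w))
              (by fun_prop) (by fun_prop)]
      _ = ∫⁻ z, s z * s z * (s z)⁻¹ := by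
          refine lintegral_congr_ae ?_
          filter_upwards [d1, d2] with z h1 h2
          rw [← h1, ← h2]
      _ ≤ ∫⁻ z, s z := by
          refine lintegral_mono fun z => ?_
          rw [mul_assoc]
          exact mul_le_of_le_one_right' (ENNReal.mul_inv_le_one _)
      _ ≤ 1 := hs1
  rw [← integral_congr_ae hcongr, integral_sub (by exact i2.add i3) (by exact i1.add i4),
    integral_add i2 i3,
    integral_add i1 i4, e1, e2, e3, e4] at key
  linarith

lemma finEnt_of_bdd (μ : Measure E) [IsProbabilityMeasure μ] (hμ : μ ≪ volume) (C : ℝ≥0∞)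
    (hC : C ≠ ∞) (hle : μ ≤ C • volume) (h2 : Integrable (fun x => ‖x‖ ^ 2) μ) : FinEnt μ := by
  have mp : Measurable (μ.rnDeriv volume) := Measure.measurable_rnDeriv _ _
  have hpC : ∀ᵐ x, μ.rnDeriv volume x ≤ C := by
    refine ae_le_of_forall_setLIntegral_le_of_sigmaFinite mp fun s hs _ => ?_
    rw [Measure.setLIntegral_rnDeriv hμ, setLIntegral_const]
    simpa using hle s
  have hg : Integrable (fun v : E => Real.exp (-1 * ‖v‖ ^ 2)) := by
    have := (GaussianFourier.integrable_cexp_neg_mul_sq_norm_add (b := 1) (V := E)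
      (by simp) 0 0).norm
    refine this.congr (ae_of_all _ fun v => ?_)
    simp [Complex.norm_exp, ← Complex.ofReal_pow]
  have hp1 : Integrable (fun x => (μ.rnDeriv volume x).toReal) := Measure.integrable_toReal_rnDeriv
  have hp2 : Integrable (fun x => (μ.rnDeriv volume x).toReal * ‖x‖ ^ 2) :=
    (integrable_rnDeriv_smul_iff hμ).2 h2
  refine Integrable.mono' ((hp2.add (hp1.mul_const |Real.log C.toReal|)).add hg)
    (mp.ennreal_toReal.mul (Real.measurable_log.comp mp.ennreal_toReal)).aestronglyMeasurable ?_
  filter_upwards [hpC] with x hx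
  have hx' : (μ.rnDeriv volume x).toReal ≤ C.toReal := ENNReal.toReal_mono hC hx
  have h0 : 0 ≤ (μ.rnDeriv volume x).toReal := ENNReal.toReal_nonneg
  simp only [Pi.add_apply]
  generalize (μ.rnDeriv volume x).toReal = p at hx' h0 ⊢
  rcases h0.eq_or_lt with rfl | hp
  · simp; positivity
  have hgp : 0 < Real.exp (-1 * ‖x‖ ^ 2) := Real.exp_pos _
  have hl : Real.log p ≤ |Real.log C.toReal| := (Real.log_le_log hp hx').trans (le_abs_self _)
  have hu := Real.log_le_sub_one_of_pos (div_pos hgp hp)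
  rw [Real.log_div hgp.ne' hp.ne', Real.log_exp] at hu
  have hu2 : p * (-1 * ‖x‖ ^ 2 - Real.log p) ≤ Real.exp (-1 * ‖x‖ ^ 2) - p := by
    calc _ ≤ p * (Real.exp (-1 * ‖x‖ ^ 2) / p - 1) := mul_le_mul_of_nonneg_left hu hp.le
      _ = _ := by field_simp
  have hl2 := mul_le_mul_of_nonneg_left hl hp.le
  have hn : 0 ≤ p * ‖x‖ ^ 2 := by positivity
  have hn2 : 0 ≤ p * |Real.log C.toReal| := by positivity
  rw [Real.norm_eq_abs, abs_le]
  constructor <;> nlinarith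

lemma conv_le_smul (μ ν : Measure E) [IsProbabilityMeasure μ] [IsProbabilityMeasure ν] (C : ℝ≥0∞)
    (hle : ν ≤ C • volume) : μ.conv ν ≤ C • volume := by
  refine Measure.le_intro fun s hs _ => ?_
  rw [← lintegral_indicator_one hs, Measure.lintegral_conv (measurable_one.indicator hs)]
  calc ∫⁻ x, ∫⁻ y, s.indicator 1 (x + y) ∂ν ∂μ ≤ ∫⁻ x, (C • volume) s ∂μ := by
        refine lintegral_mono fun x => ?_
        refine (lintegral_mono' hle le_rfl).trans ?_
        rw [lintegral_smul_measure, lintegral_add_left_eq_self (s.indicator 1) x,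
          lintegral_indicator_one hs]
        rfl
    _ = _ := by simp

end General

lemma concave_of_submod (f : ℝ → ℝ) (hmono : ∀ t s, 0 ≤ t → 0 ≤ s → f t ≤ f (t + s))
    (hsub : ∀ t s u, 0 ≤ t → 0 ≤ s → 0 ≤ u → f (t + s + u) + f t ≤ f (t + s) + f (t + u)) :
    ConcaveOn ℝ (Set.Ici (0 : ℝ)) f := by
  have hD : ∀ t d, 0 ≤ t → 0 ≤ d → ∀ k N : ℕ, k ≤ N →
      f (t + (N + 1) * d) - f (t + N * d) ≤ f (t + (k + 1) * d) - f (t + k * d) := by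
    intro t d ht hd k N hk
    have hk' : (0 : ℝ) ≤ N - k := sub_nonneg.2 (by exact_mod_cast hk)
    have := hsub (t + k * d) d ((N - k) * d) (by positivity) hd (by positivity)
    rw [show t + k * d + d + (N - k) * d = t + (N + 1) * d by ring,
      show t + k * d + d = t + (k + 1) * d by ring,
      show t + k * d + (N - k) * d = t + N * d by ring] at this
    linarith
  have hA : ∀ t d, 0 ≤ t → 0 ≤ d → ∀ N k : ℕ, k ≤ N →
      k * (f (t + (N + 1) * d) - f (t + N * d)) ≤ f (t + k * d) - f t := by
    intro t d ht hd N k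
    induction k with
    | zero => intro _; simp
    | succ k ih =>
      intro hk
      have h1 := ih (by omega)
      have h2 := hD t d ht hd k N (by omega)
      push_cast
      linarith
  have hB : ∀ t d, 0 ≤ t → 0 ≤ d → ∀ k N : ℕ, k ≤ N →
      k * (f (t + N * d) - f t) ≤ N * (f (t + k * d) - f t) := by
    intro t d ht hd k N hk
    induction N, hk using Nat.le_induction with
    | base => exact le_rfl
    | succ N hN ih =>
      have h1 := hA t d ht hd N k hN
      push_cast
      linarith
  refine LinearOrder.concaveOn_of_lt (convex_Ici 0) ?_
  intro x hx y hy hxy a b ha hb hab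
  have hx0 : 0 ≤ x := hx
  simp only [smul_eq_mul]
  have hΔ : 0 ≤ f y - f x := by
    have := hmono x (y - x) hx0 (by linarith)
    rw [add_sub_cancel] at this; linarith
  have hN : ∀ N : ℕ, N * (b * (f y - f x) - (f (a * x + b * y) - f x)) ≤ f y - f x := by
    intro N
    rcases Nat.eq_zero_or_pos N with rfl | hNpos
    · simpa using hΔ
    have hNr : (0 : ℝ) < N := by exact_mod_cast hNpos
    have hd : 0 ≤ (y - x) / N := div_nonneg (by linarith) hNr.le
    have hk1 : (⌊b * N⌋₊ : ℝ) ≤ b * N := Nat.floor_le (by positivity)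
    have hk2 : b * N < ⌊b * N⌋₊ + 1 := Nat.lt_floor_add_one _
    generalize ⌊b * N⌋₊ = k at hk1 hk2
    have hkN : k ≤ N := by
      have : (k : ℝ) ≤ N := by nlinarith
      exact_mod_cast this
    have h1 := hB x ((y - x) / N) hx0 hd k N hkN
    rw [show x + N * ((y - x) / N) = y by field_simp; ring] at h1
    have h3 : x + k * ((y - x) / N) ≤ a * x + b * y := by
      have : k * ((y - x) / N) ≤ b * N * ((y - x) / N) := mul_le_mul_of_nonneg_right hk1 hd
      have e : b * N * ((y - x) / N) = b * (y - x) := by field_simp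
      have ea : a = 1 - b := by linarith
      rw [e] at this; rw [ea]; linarith
    have h4 := hmono (x + k * ((y - x) / N)) (a * x + b * y - (x + k * ((y - x) / N)))
      (by positivity) (by linarith)
    rw [add_sub_cancel] at h4
    have h5 : N * (f (x + k * ((y - x) / N)) - f x) ≤ N * (f (a * x + b * y) - f x) :=
      mul_le_mul_of_nonneg_left (by linarith) hNr.le
    have h6 : (b * N - 1) * (f y - f x) ≤ k * (f y - f x) :=
      mul_le_mul_of_nonneg_right (by linarith) hΔ
    linarith
  have : b * (f y - f x) - (f (a * x + b * y) - f x) ≤ 0 := by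
    by_contra! hc
    obtain ⟨N, hN'⟩ := exists_nat_gt ((f y - f x) / (b * (f y - f x) - (f (a * x + b * y) - f x)))
    rw [div_lt_iff₀ hc] at hN'
    linarith [hN N]
  have ea : a = 1 - b := by linarith
  have : b * (f y - f x) - (f (a * x + b * y) - f x) = (a * f x + b * f y) - f (a * x + b * y) := by
    rw [ea]; ring
  linarith

section Gauss

variable {n : ℕ}

lemma stdGaussian_eq (n : ℕ) [IsProbabilityMeasure (_root_.stdGaussian n)] :
    _root_.stdGaussian n = ProbabilityTheory.stdGaussian (EuclideanSpace ℝ (Fin n)) := by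
  apply Measure.ext_of_charFun
  ext t
  rw [charFun_stdGaussian, charFun_apply, _root_.stdGaussian,
    integral_withDensity_eq_integral_toReal_smul (by fun_prop) (by simp)]
  have h := GaussianFourier.integral_cexp_neg_mul_sq_norm_add (b := 1 / 2)
    (V := EuclideanSpace ℝ (Fin n)) (by norm_num) Complex.I t
  have hpos : (0 : ℝ) < 2 * π := by positivity
  have e : ∀ x : EuclideanSpace ℝ (Fin n),
      (ENNReal.ofReal ((2 * π) ^ (-(n : ℝ) / 2) * Real.exp (-‖x‖ ^ 2 / 2))).toReal •
        Complex.exp (inner ℝ x t * Complex.I) =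
      (((2 * π) ^ (-(n : ℝ) / 2) : ℝ) : ℂ) *
        Complex.exp (-(1 / 2) * ‖x‖ ^ 2 + Complex.I * inner ℝ t x) := by
    intro x
    rw [ENNReal.toReal_ofReal (by positivity), Complex.real_smul, Complex.ofReal_mul, mul_assoc,
      Complex.ofReal_exp, ← Complex.exp_add, real_inner_comm]
    congr 2
    push_cast
    ring
  simp_rw [e]
  rw [integral_const_mul, h, finrank_euclideanSpace_fin, ← mul_assoc]
  have e2 : (((2 * π) ^ (-(n : ℝ) / 2) : ℝ) : ℂ) * (π / (1 / 2) : ℂ) ^ ((n : ℂ) / 2) = 1 := by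
    rw [show (π / (1 / 2) : ℂ) ^ ((n : ℂ) / 2) = (((2 * π) ^ ((n : ℝ) / 2) : ℝ) : ℂ) by
      rw [Complex.ofReal_cpow hpos.le]; push_cast; congr 1; ring,
      ← Complex.ofReal_mul, ← Real.rpow_add hpos]
    rw [show -(n : ℝ) / 2 + n / 2 = 0 by ring]; simp
  rw [e2, one_mul]
  congr 1
  rw [Complex.I_sq]
  ring

/-- Gaussian measure of variance `t`. -/
def gam (n : ℕ) (t : ℝ) : Measure (EuclideanSpace ℝ (Fin n)) :=
  (ProbabilityTheory.stdGaussian (EuclideanSpace ℝ (Fin n))).map (fun x => √t • x)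

instance (n : ℕ) (t : ℝ) : IsProbabilityMeasure (gam n t) :=
  Measure.isProbabilityMeasure_map (by fun_prop)

lemma gam_conv (n : ℕ) {s t : ℝ} (hs : 0 ≤ s) (ht : 0 ≤ t) :
    (gam n s).conv (gam n t) = gam n (s + t) := by
  apply Measure.ext_of_charFun
  ext w
  rw [charFun_conv]
  simp only [gam]
  rw [charFun_map_smul, charFun_map_smul, charFun_map_smul, charFun_stdGaussian,
    charFun_stdGaussian, charFun_stdGaussian, ← Complex.exp_add]
  congr 1
  simp only [norm_smul, Real.norm_eq_abs, Complex.ofReal_mul, mul_pow, ← Complex.ofReal_pow, sq_abs,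
    Real.sq_sqrt hs, Real.sq_sqrt ht, Real.sq_sqrt (add_nonneg hs ht)]
  push_cast
  ring

lemma gam_zero (n : ℕ) : gam n 0 = Measure.dirac 0 := by
  simp [gam]

lemma gam_le (n : ℕ) [IsProbabilityMeasure (_root_.stdGaussian n)] {t : ℝ} (ht : 0 < t) :
    ∃ C : ℝ≥0∞, C ≠ ∞ ∧ gam n t ≤ C • volume := by
  have h1 : _root_.stdGaussian n ≤ ENNReal.ofReal ((2 * π) ^ (-(n : ℝ) / 2)) • volume := by
    rw [_root_.stdGaussian, ← withDensity_const]
    refine withDensity_mono (ae_of_all _ fun x => ?_)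
    refine ENNReal.ofReal_le_ofReal ?_
    refine mul_le_of_le_one_right (by positivity) ?_
    rw [Real.exp_le_one_iff]
    have := sq_nonneg ‖x‖
    linarith
  rw [gam, ← stdGaussian_eq]
  have h2 := Measure.map_mono h1 (f := fun x => √t • x) (by fun_prop)
  rw [Measure.map_smul, Measure.map_addHaar_smul volume (Real.sqrt_pos.2 ht).ne', smul_smul] at h2
  exact ⟨_, ENNReal.mul_ne_top ENNReal.ofReal_ne_top ENNReal.ofReal_ne_top, h2⟩

end Gauss

/-- Concavity of the entropy along the heat semigroup: `t ↦ S(X + √t Z)` is concave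
on `[0, ∞)`. -/
theorem entropy_heat_concave
    {Ω : Type*} [MeasureSpace Ω] [IsProbabilityMeasure (ℙ : Measure Ω)] {n : ℕ}
    (X Z : Ω → EuclideanSpace ℝ (Fin n)) (hX : Measurable X) (hZ : Measurable Z)
    (hindep : IndepFun X Z ℙ) (hZlaw : Measure.map Z ℙ = stdGaussian n)
    (hXac : Measure.map X ℙ ≪ volume)
    (hX2 : Integrable (fun ω => ‖X ω‖ ^ 2) ℙ)
    (hent : Integrable
      (fun x => ((Measure.map X ℙ).rnDeriv volume x).toReal
        * Real.log (((Measure.map X ℙ).rnDeriv volume x).toReal)) volume) :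
    ConcaveOn ℝ (Set.Ici (0 : ℝ))
      (fun t : ℝ =>
        diffEntropy volume (Measure.map (fun ω => X ω + Real.sqrt t • Z ω) ℙ)) := by
  have : IsProbabilityMeasure (_root_.stdGaussian n) := by
    rw [← hZlaw]; exact Measure.isProbabilityMeasure_map hZ.aemeasurable
  have hμP : IsProbabilityMeasure (Measure.map X ℙ) :=
    Measure.isProbabilityMeasure_map hX.aemeasurable
  have hlaw : ∀ t : ℝ, Measure.map (fun ω => X ω + √t • Z ω) ℙ
      = (Measure.map X ℙ).conv (gam n t) := by
    intro t
    have hm : Measurable (fun ω => √t • Z ω) := by fun_prop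
    have hi : IndepFun X (fun ω => √t • Z ω) ℙ :=
      hindep.comp measurable_id (measurable_const_smul (√t))
    have h1 := hi.map_add_eq_map_conv_map hX hm
    have h2 : Measure.map (fun ω => √t • Z ω) ℙ = gam n t := by
      rw [gam, ← stdGaussian_eq, ← hZlaw, Measure.map_map (by fun_prop) hZ]
      rfl
    rw [h2] at h1
    exact h1
  have hX2' : MemLp X 2 ℙ := (memLp_two_iff_integrable_sq_norm hX.aestronglyMeasurable).2 hX2
  have hZ2' : MemLp Z 2 ℙ := by
    have h1 : MemLp id 2 (Measure.map Z ℙ) := by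
      rw [hZlaw, stdGaussian_eq]
      exact IsGaussian.memLp_id _ 2 (by norm_num)
    exact h1.comp_of_map hZ.aemeasurable
  have hfin : ∀ t : ℝ, 0 ≤ t → FinEnt ((Measure.map X ℙ).conv (gam n t)) := by
    intro t ht
    rcases ht.eq_or_lt with rfl | ht
    · rw [gam_zero, Measure.conv_dirac_zero]
      exact hent
    obtain ⟨C, hC, hle⟩ := gam_le n ht
    refine finEnt_of_bdd _ (conv_ac _ _ hXac) C hC (conv_le_smul _ _ C hle) ?_
    rw [← hlaw]
    have hm : Measurable (fun ω => X ω + √t • Z ω) := by fun_prop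
    rw [integrable_map_measure (by fun_prop) hm.aemeasurable]
    exact (memLp_two_iff_integrable_sq_norm hm.aestronglyMeasurable).1
      (hX2'.add (hZ2'.const_smul (√t)))
  have hsemi : ∀ t s : ℝ, 0 ≤ t → 0 ≤ s → (Measure.map X ℙ).conv (gam n (t + s))
      = ((Measure.map X ℙ).conv (gam n t)).conv (gam n s) := by
    intro t s ht hs
    rw [Measure.conv_assoc, gam_conv n ht hs]
  simp_rw [hlaw]
  refine concave_of_submod _ ?_ ?_
  · intro t s ht hs
    have h := hfin (t + s) (by positivity)
    rw [hsemi t s ht hs] at h ⊢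
    exact entropy_mono _ _ (conv_ac _ _ hXac) (hfin t ht) h
  · intro t s u ht hs hu
    have h1 := hfin (t + s) (by positivity)
    have h2 := hfin (t + u) (by positivity)
    have h3 := hfin (t + s + u) (by positivity)
    rw [hsemi (t + s) u (by positivity) hu] at h3 ⊢
    rw [hsemi t s ht hs] at h1 h3 ⊢
    rw [hsemi t u ht hu] at h2 ⊢
    exact entropy_submod _ _ _ (conv_ac _ _ hXac) (hfin t ht) h1 h2 h3

end
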